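/- For all X ∈ ℝ^{n×d}, Y ∈ ℝ^{m×d}, Z ∈ ℝ^{k×d} with weights p ∈ Σ_n, q ∈ Σ_m, r ∈ Σ_k, the Procrustes-Wasserstein distance satisfies the triangle inequality: PW₂(μ_X, μ_Y) ≤ PW₂(μ_X, μ_Z) + PW₂(μ_Z, μ_Y). -/

import Mathlib

open Matrix BigOperators

noncomputable section

/-- The probability simplex `Σ_n`. -/
def probSimplex (n : ℕ) : Set (Fin n → ℝ) :=
  {p | (∀ i, 0 ≤ p i) ∧ ∑ i, p i = 1}

/-- The set of admissible transport plans `Π(p, q)`. -/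
def transportPlans {n m : ℕ} (p : Fin n → ℝ) (q : Fin m → ℝ) :
    Set (Matrix (Fin n) (Fin m) ℝ) :=
  {Γ | (∀ i j, 0 ≤ Γ i j) ∧ (∀ i, ∑ j, Γ i j = p i) ∧ (∀ j, ∑ i, Γ i j = q j)}

/-- Frobenius inner product `⟨A, B⟩_F = trace(Bᵀ A)`. -/
def frob {n m : ℕ} (A B : Matrix (Fin n) (Fin m) ℝ) : ℝ :=
  (Bᵀ * A).trace

/-- Cost matrix `(C_P(X,Y))_{ij} = ‖x_i − y_j P‖₂²`. -/
def costP {n m d : ℕ} (P : Matrix (Fin d) (Fin d) ℝ)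
    (X : Matrix (Fin n) (Fin d) ℝ) (Y : Matrix (Fin m) (Fin d) ℝ) :
    Matrix (Fin n) (Fin m) ℝ :=
  Matrix.of fun i j => ∑ k, (X i k - (Y * P) j k) ^ 2

/-- Squared Procrustes–Wasserstein distance. -/
def PWsq {n m d : ℕ} (X : Matrix (Fin n) (Fin d) ℝ) (p : Fin n → ℝ)
    (Y : Matrix (Fin m) (Fin d) ℝ) (q : Fin m → ℝ) : ℝ :=
  sInf {c | ∃ P ∈ Matrix.orthogonalGroup (Fin d) ℝ,
    ∃ Γ ∈ transportPlans p q, c = frob (costP P X Y) Γ}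

/-- Procrustes–Wasserstein distance `PW₂`. -/
def PW2dist {n m d : ℕ} (X : Matrix (Fin n) (Fin d) ℝ) (p : Fin n → ℝ)
    (Y : Matrix (Fin m) (Fin d) ℝ) (q : Fin m → ℝ) : ℝ :=
  Real.sqrt (PWsq X p Y q)

/-- Squared discrete 2-Wasserstein distance. -/
def W2sq {n m d : ℕ} (X : Matrix (Fin n) (Fin d) ℝ) (p : Fin n → ℝ)
    (Y : Matrix (Fin m) (Fin d) ℝ) (q : Fin m → ℝ) : ℝ :=
  sInf {c | ∃ Γ ∈ transportPlans p q, c = frob (costP 1 X Y) Γ}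

/-- Discrete 2-Wasserstein distance `W₂`. -/
def W2dist {n m d : ℕ} (X : Matrix (Fin n) (Fin d) ℝ) (p : Fin n → ℝ)
    (Y : Matrix (Fin m) (Fin d) ℝ) (q : Fin m → ℝ) : ℝ :=
  Real.sqrt (W2sq X p Y q)

theorem frob_eq_sum {n m : ℕ} (A B : Matrix (Fin n) (Fin m) ℝ) :
    frob A B = ∑ i, ∑ j, B i j * A i j := by
  rw [Finset.sum_comm]
  simp [frob, Matrix.trace, Matrix.mul_apply]

theorem frob_costP_nonneg {n m d : ℕ} (P : Matrix (Fin d) (Fin d) ℝ)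
    (X : Matrix (Fin n) (Fin d) ℝ) (Y : Matrix (Fin m) (Fin d) ℝ)
    {Γ : Matrix (Fin n) (Fin m) ℝ} (hΓ : ∀ i j, 0 ≤ Γ i j) : 0 ≤ frob (costP P X Y) Γ := by
  rw [frob_eq_sum]
  refine Finset.sum_nonneg fun i _ => Finset.sum_nonneg fun j _ => mul_nonneg (hΓ i j) ?_
  rw [costP, Matrix.of_apply]
  positivity

/-- The product coupling is a transport plan. -/
theorem vecMulVec_mem_transportPlans {n m : ℕ} {p : Fin n → ℝ} {q : Fin m → ℝ}
    (hp : p ∈ probSimplex n) (hq : q ∈ probSimplex m) :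
    Matrix.vecMulVec p q ∈ transportPlans p q := by
  refine ⟨fun i j => mul_nonneg (hp.1 i) (hq.1 j), fun i => ?_, fun j => ?_⟩
  · simp [Matrix.vecMulVec_apply, ← Finset.mul_sum, hq.2]
  · simp [Matrix.vecMulVec_apply, ← Finset.sum_mul, hp.2]

/-- The gluing of two plans along their common marginal `r`. -/
def gluePlan {n k m : ℕ} (Γ : Matrix (Fin n) (Fin k) ℝ) (r : Fin k → ℝ)
    (Δ : Matrix (Fin k) (Fin m) ℝ) (i : Fin n) (l : Fin k) (j : Fin m) : ℝ :=
  Γ i l * Δ l j / r l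

section Glue

variable {n k m : ℕ} {p : Fin n → ℝ} {r : Fin k → ℝ} {q : Fin m → ℝ}
  {Γ : Matrix (Fin n) (Fin k) ℝ} {Δ : Matrix (Fin k) (Fin m) ℝ}

theorem gluePlan_nonneg (hΓ : Γ ∈ transportPlans p r) (hΔ : Δ ∈ transportPlans r q)
    (i : Fin n) (l : Fin k) (j : Fin m) : 0 ≤ gluePlan Γ r Δ i l j :=
  div_nonneg (mul_nonneg (hΓ.1 i l) (hΔ.1 l j))
    (hΓ.2.2 l ▸ Finset.sum_nonneg fun i _ => hΓ.1 i l)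

theorem sum_gluePlan_right (hΓ : Γ ∈ transportPlans p r) (hΔ : Δ ∈ transportPlans r q)
    (i : Fin n) (l : Fin k) : ∑ j, gluePlan Γ r Δ i l j = Γ i l := by
  simp only [gluePlan]
  rw [← Finset.sum_div, ← Finset.mul_sum, hΔ.2.1 l]
  refine mul_div_cancel_of_imp fun h => ?_
  exact (Finset.sum_eq_zero_iff_of_nonneg fun i _ => hΓ.1 i l).1
    ((hΓ.2.2 l).trans h) i (Finset.mem_univ i)

theorem sum_gluePlan_left (hΓ : Γ ∈ transportPlans p r) (hΔ : Δ ∈ transportPlans r q)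
    (l : Fin k) (j : Fin m) : ∑ i, gluePlan Γ r Δ i l j = Δ l j := by
  simp only [gluePlan]
  rw [← Finset.sum_div, ← Finset.sum_mul, hΓ.2.2 l]
  refine mul_div_cancel_left_of_imp fun h => ?_
  exact (Finset.sum_eq_zero_iff_of_nonneg fun j _ => hΔ.1 l j).1
    ((hΔ.2.1 l).trans h) j (Finset.mem_univ j)

theorem sum_gluePlan_mem_transportPlans (hΓ : Γ ∈ transportPlans p r)
    (hΔ : Δ ∈ transportPlans r q) :
    (Matrix.of fun i j => ∑ l, gluePlan Γ r Δ i l j) ∈ transportPlans p q := by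
  refine ⟨fun i j => ?_, fun i => ?_, fun j => ?_⟩
  · rw [Matrix.of_apply]
    exact Finset.sum_nonneg fun l _ => gluePlan_nonneg hΓ hΔ i l j
  · simp only [Matrix.of_apply]
    rw [Finset.sum_comm]
    simp only [sum_gluePlan_right hΓ hΔ, hΓ.2.1 i]
  · simp only [Matrix.of_apply]
    rw [Finset.sum_comm]
    simp only [sum_gluePlan_left hΓ hΔ, hΔ.2.2 j]

end Glue

/-- Weighted Minkowski inequality for `L²`. -/
theorem sqrt_sum_mul_add_sq_le {ι : Type*} [Fintype ι] {w : ι → ℝ} (hw : ∀ i, 0 ≤ w i)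
    (f g : ι → ℝ) :
    √(∑ i, w i * (f i + g i) ^ 2) ≤ √(∑ i, w i * f i ^ 2) + √(∑ i, w i * g i ^ 2) := by
  have key := norm_add_le (WithLp.toLp 2 fun i => √(w i) * f i : EuclideanSpace ℝ ι)
    (WithLp.toLp 2 fun i => √(w i) * g i)
  simpa [EuclideanSpace.norm_eq, ← mul_add, mul_pow, Real.sq_sqrt, hw] using key

theorem sum_vecMul_sq_of_mem_orthogonalGroup {d : ℕ} {P : Matrix (Fin d) (Fin d) ℝ}
    (hP : P ∈ Matrix.orthogonalGroup (Fin d) ℝ) (v : Fin d → ℝ) :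
    ∑ t, (v ᵥ* P) t ^ 2 = ∑ t, v t ^ 2 := by
  have h : (v ᵥ* P) ⬝ᵥ (v ᵥ* P) = v ⬝ᵥ v := by
    have hPP : P * Pᵀ = 1 := (Matrix.mem_orthogonalGroup_iff _ _).1 hP
    rw [← Matrix.dotProduct_mulVec, ← Matrix.mulVec_transpose, Matrix.mulVec_mulVec, hPP,
      Matrix.one_mulVec]
  simpa [dotProduct, sq] using h

/-- Triangle inequality at the level of a pair of plans and orthogonal matrices. -/
theorem exists_sqrt_frob_costP_le {n m k d : ℕ}
    (X : Matrix (Fin n) (Fin d) ℝ) (Y : Matrix (Fin m) (Fin d) ℝ)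
    (Z : Matrix (Fin k) (Fin d) ℝ)
    {p : Fin n → ℝ} {q : Fin m → ℝ} {r : Fin k → ℝ}
    {P : Matrix (Fin d) (Fin d) ℝ} (hP : P ∈ Matrix.orthogonalGroup (Fin d) ℝ)
    (Q : Matrix (Fin d) (Fin d) ℝ)
    {Γ : Matrix (Fin n) (Fin k) ℝ} (hΓ : Γ ∈ transportPlans p r)
    {Δ : Matrix (Fin k) (Fin m) ℝ} (hΔ : Δ ∈ transportPlans r q) :
    ∃ Θ ∈ transportPlans p q, √(frob (costP (Q * P) X Y) Θ) ≤
      √(frob (costP P X Z) Γ) + √(frob (costP Q Z Y) Δ) := by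
  refine ⟨_, sum_gluePlan_mem_transportPlans hΓ hΔ, ?_⟩
  let w : Fin n × Fin k × Fin m × Fin d → ℝ := fun a => gluePlan Γ r Δ a.1 a.2.1 a.2.2.1
  let f : Fin n × Fin k × Fin m × Fin d → ℝ := fun a =>
    X a.1 a.2.2.2 - (Z * P) a.2.1 a.2.2.2
  let g : Fin n × Fin k × Fin m × Fin d → ℝ := fun a =>
    (Z * P) a.2.1 a.2.2.2 - (Y * (Q * P)) a.2.2.1 a.2.2.2
  have hXY : ∑ a, w a * (f a + g a) ^ 2 = frob (costP (Q * P) X Y)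
      (Matrix.of fun i j => ∑ l, gluePlan Γ r Δ i l j) := by
    simp only [frob_eq_sum, Fintype.sum_prod_type, w, f, g, costP, Matrix.of_apply,
      sub_add_sub_cancel, ← Finset.mul_sum, Finset.sum_mul]
    exact Finset.sum_congr rfl fun i _ => Finset.sum_comm
  have hXZ : ∑ a, w a * f a ^ 2 = frob (costP P X Z) Γ := by
    simp only [frob_eq_sum, Fintype.sum_prod_type, w, f, costP, Matrix.of_apply,
      ← Finset.mul_sum, ← Finset.sum_mul, sum_gluePlan_right hΓ hΔ]
  have hrot (l : Fin k) (j : Fin m) :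
      ∑ t, ((Z * P) l t - (Y * (Q * P)) j t) ^ 2 = ∑ t, (Z l t - (Y * Q) j t) ^ 2 := by
    rw [← sum_vecMul_sq_of_mem_orthogonalGroup hP fun t => Z l t - (Y * Q) j t]
    refine Finset.sum_congr rfl fun t _ => ?_
    rw [← Matrix.mul_assoc]
    simp [Matrix.vecMul, dotProduct, Matrix.mul_apply (M := Z),
      Matrix.mul_apply (M := Y * Q), sub_mul]
  have hZY : ∑ a, w a * g a ^ 2 = frob (costP Q Z Y) Δ := by
    simp only [frob_eq_sum, Fintype.sum_prod_type, w, g, costP, Matrix.of_apply,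
      ← Finset.mul_sum, hrot]
    rw [Finset.sum_comm]
    refine Finset.sum_congr rfl fun l _ => ?_
    rw [Finset.sum_comm]
    simp only [← Finset.sum_mul, sum_gluePlan_left hΓ hΔ]
  rw [← hXY, ← hXZ, ← hZY]
  exact sqrt_sum_mul_add_sq_le (fun a => gluePlan_nonneg hΓ hΔ _ _ _) f g

theorem le_PW2dist {n m d : ℕ} {X : Matrix (Fin n) (Fin d) ℝ} {p : Fin n → ℝ}
    {Y : Matrix (Fin m) (Fin d) ℝ} {q : Fin m → ℝ}
    (hp : p ∈ probSimplex n) (hq : q ∈ probSimplex m) {a : ℝ}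
    (h : ∀ P ∈ Matrix.orthogonalGroup (Fin d) ℝ, ∀ Γ ∈ transportPlans p q,
      a ≤ √(frob (costP P X Y) Γ)) : a ≤ PW2dist X p Y q := by
  rcases le_or_gt a 0 with ha | ha
  · exact ha.trans (Real.sqrt_nonneg _)
  · refine Real.le_sqrt_of_sq_le (le_csInf
      ⟨_, 1, one_mem _, _, vecMulVec_mem_transportPlans hp hq, rfl⟩ ?_)
    rintro _ ⟨P, hP, Γ, hΓ, rfl⟩
    exact (Real.le_sqrt' ha).1 (h P hP Γ hΓ)

theorem PW2dist_le {n m d : ℕ} (X : Matrix (Fin n) (Fin d) ℝ) {p : Fin n → ℝ}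
    (Y : Matrix (Fin m) (Fin d) ℝ) {q : Fin m → ℝ}
    {P : Matrix (Fin d) (Fin d) ℝ} (hP : P ∈ Matrix.orthogonalGroup (Fin d) ℝ)
    {Γ : Matrix (Fin n) (Fin m) ℝ} (hΓ : Γ ∈ transportPlans p q) :
    PW2dist X p Y q ≤ √(frob (costP P X Y) Γ) := by
  refine Real.sqrt_le_sqrt (csInf_le ⟨0, ?_⟩ ⟨P, hP, Γ, hΓ, rfl⟩)
  rintro _ ⟨P, -, Γ, hΓ, rfl⟩
  exact frob_costP_nonneg P X Y hΓ.1

/-- the Procrustes–Wasserstein distance satisfies the triangle inequality. -/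
theorem pw_triangle {n m k d : ℕ}
    (X : Matrix (Fin n) (Fin d) ℝ) (Y : Matrix (Fin m) (Fin d) ℝ)
    (Z : Matrix (Fin k) (Fin d) ℝ)
    (p : Fin n → ℝ) (q : Fin m → ℝ) (r : Fin k → ℝ)
    (hp : p ∈ probSimplex n) (hq : q ∈ probSimplex m) (hr : r ∈ probSimplex k) :
    PW2dist X p Y q ≤ PW2dist X p Z r + PW2dist Z r Y q := by
  rw [← sub_le_iff_le_add]
  refine le_PW2dist hp hr fun P hP Γ hΓ => ?_
  rw [sub_le_comm]
  refine le_PW2dist hr hq fun Q hQ Δ hΔ => ?_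
  obtain ⟨Θ, hΘ, h⟩ := exists_sqrt_frob_costP_le X Y Z hP Q hΓ hΔ
  rw [sub_le_iff_le_add']
  exact (PW2dist_le X Y (mul_mem hQ hP) hΘ).trans h
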